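/- The canonical monoid homomorphism from the positive braid monoid B_n^+ to the braid group B_n (sending each generator σ_i of the monoid to the corresponding generator of the group) is injective. -/

import Mathlib

/-- The braid relations on the free monoid over `Fin (n - 1)`: the index `i : Fin (n - 1)`
stands for the Artin generator `σ_{i+1}` (indices are 0-based), and the relations are
`σ_i σ_j σ_i = σ_j σ_i σ_j` for `|i - j| = 1` and `σ_i σ_j = σ_j σ_i` for `|i - j| ≥ 2`. -/
def braidRels (n : ℕ) : FreeMonoid (Fin (n - 1)) → FreeMonoid (Fin (n - 1)) → Prop :=
  fun x y =>
    (∃ i j : Fin (n - 1), (i : ℕ) + 1 = (j : ℕ) ∧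
        x = .of i * .of j * .of i ∧ y = .of j * .of i * .of j) ∨
    (∃ i j : Fin (n - 1), (i : ℕ) + 2 ≤ (j : ℕ) ∧
        x = .of i * .of j ∧ y = .of j * .of i)

/-- The positive braid monoid `B_n⁺`, presented by the generators `σ_1, …, σ_{n-1}`
and the braid relations. -/
def BraidMonoid (n : ℕ) := PresentedMonoid (braidRels n)

instance (n : ℕ) : Monoid (BraidMonoid n) :=
  inferInstanceAs (Monoid (PresentedMonoid (braidRels n)))

/-- The generator `σ_{i+1}` of `B_n⁺` (0-based index `i : Fin (n - 1)`). -/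
def σ {n : ℕ} (i : Fin (n - 1)) : BraidMonoid n := PresentedMonoid.of (braidRels n) i

/-- The braid relators in the free group over `Fin (n - 1)`: the index `i` stands for the
Artin generator `σ_{i+1}` (indices are 0-based), and the relators express
`σ_i σ_j σ_i = σ_j σ_i σ_j` for `|i - j| = 1` and `σ_i σ_j = σ_j σ_i` for `|i - j| ≥ 2`. -/
def braidRelsGroup (n : ℕ) : Set (FreeGroup (Fin (n - 1))) :=
  { r | (∃ i j : Fin (n - 1), (i : ℕ) + 1 = (j : ℕ) ∧
          r = .of i * .of j * .of i * (.of j * .of i * .of j)⁻¹) ∨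
        (∃ i j : Fin (n - 1), (i : ℕ) + 2 ≤ (j : ℕ) ∧
          r = .of i * .of j * (.of j * .of i)⁻¹) }

/-- The braid group `B_n`, presented by the generators `σ_1, …, σ_{n-1}` and the
braid relations. -/
def BraidGroup (n : ℕ) := PresentedGroup (braidRelsGroup n)

instance (n : ℕ) : Group (BraidGroup n) :=
  inferInstanceAs (Group (PresentedGroup (braidRelsGroup n)))

/-- The generator `σ_{i+1}` of the braid group `B_n` (0-based index `i : Fin (n - 1)`). -/
def σG {n : ℕ} (i : Fin (n - 1)) : BraidGroup n := PresentedGroup.of i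

theorem braidGroup_rel_eq {n : ℕ} {x y : FreeGroup (Fin (n - 1))}
    (hr : x * y⁻¹ ∈ braidRelsGroup n) :
    PresentedGroup.mk (braidRelsGroup n) x = PresentedGroup.mk (braidRelsGroup n) y := by
  have h1 : PresentedGroup.mk (braidRelsGroup n) (x * y⁻¹) = 1 :=
    (QuotientGroup.eq_one_iff _).mpr (Subgroup.subset_normalClosure hr)
  rw [map_mul, map_inv] at h1
  exact mul_inv_eq_one.mp h1

theorem braidRels_hold (n : ℕ) (a b : FreeMonoid (Fin (n - 1))) (h : braidRels n a b) :
    FreeMonoid.lift (fun i => σG (n := n) i) a = FreeMonoid.lift (fun i => σG (n := n) i) b := by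
  obtain ⟨i, j, hij, rfl, rfl⟩ | ⟨i, j, hij, rfl, rfl⟩ := h
  · simp only [map_mul, FreeMonoid.lift_eval_of]
    exact braidGroup_rel_eq (Or.inl ⟨i, j, hij, by simp [mul_assoc]⟩)
  · simp only [map_mul, FreeMonoid.lift_eval_of]
    exact braidGroup_rel_eq (Or.inr ⟨i, j, hij, by simp [mul_assoc]⟩)

/-- The canonical monoid homomorphism `B_n⁺ →* B_n`, sending each generator `σ_i` of the
monoid to the corresponding generator of the group. -/
def toBraidGroup (n : ℕ) : BraidMonoid n →* BraidGroup n :=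
  PresentedMonoid.lift (fun i => σG (n := n) i) (braidRels_hold n)

theorem toBraidGroup_sigma (n : ℕ) (i : Fin (n - 1)) : toBraidGroup n (σ i) = σG i := rfl

/-! ### The half twist in a monoid with braid generators -/

section HalfTwist

variable {M : Type*} [Monoid M]

/-- The descending product `s (k - 1) * ⋯ * s 1 * s 0`. -/
def descProd (s : ℕ → M) : ℕ → M
  | 0 => 1
  | k + 1 => s k * descProd s k

/-- The half twist on `k` strands. -/
def halfTwist (s : ℕ → M) : ℕ → M
  | 0 => 1
  | k + 1 => halfTwist s k * descProd s k

theorem descProd_succ (s : ℕ → M) (k : ℕ) : descProd s (k + 1) = s k * descProd s k := rfl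

theorem commute_descProd {s : ℕ → M} (hcomm : ∀ i j, i + 2 ≤ j → s i * s j = s j * s i)
    {j k : ℕ} (h : k + 1 ≤ j) : Commute (s j) (descProd s k) := by
  induction k with
  | zero => exact Commute.one_right _
  | succ k ih => exact Commute.mul_right (hcomm k j (by omega)).symm (ih (by omega))

theorem commute_halfTwist {s : ℕ → M} (hcomm : ∀ i j, i + 2 ≤ j → s i * s j = s j * s i)
    {j k : ℕ} (h : k ≤ j) : Commute (s j) (halfTwist s k) := by
  induction k with
  | zero => exact Commute.one_right _
  | succ k ih => exact (ih (by omega)).mul_right (commute_descProd hcomm h)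

theorem exists_descProd_eq_mul (s : ℕ → M) (k : ℕ) : ∃ y, descProd s (k + 1) = y * s 0 := by
  induction k with
  | zero => exact ⟨1, by simp [descProd]⟩
  | succ k ih =>
    obtain ⟨y, hy⟩ := ih
    exact ⟨s (k + 1) * y, by rw [descProd, hy, mul_assoc]⟩

theorem mul_descProd {s : ℕ → M} {m : ℕ} (hcomm : ∀ i j, i + 2 ≤ j → s i * s j = s j * s i)
    (hbraid : ∀ i, i + 1 < m → s i * s (i + 1) * s i = s (i + 1) * s i * s (i + 1))
    {i k : ℕ} (hk : k ≤ m) (hi : i + 2 ≤ k) :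
    s i * descProd s k = descProd s k * s (i + 1) := by
  induction k with
  | zero => omega
  | succ k ih =>
    obtain rfl | h := eq_or_lt_of_le (show i + 1 ≤ k by omega)
    · have hc : s (i + 1) * descProd s i = descProd s i * s (i + 1) :=
        commute_descProd hcomm le_rfl
      simp only [descProd, mul_assoc, ← hc]
      simp only [← mul_assoc, hbraid i (by omega)]
    · rw [descProd, ← mul_assoc, hcomm i k h, mul_assoc, ih (by omega) h, mul_assoc]

theorem descProd_mul_descProd_mul {s : ℕ → M} {m : ℕ}
    (hcomm : ∀ i j, i + 2 ≤ j → s i * s j = s j * s i)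
    (hbraid : ∀ i, i + 1 < m → s i * s (i + 1) * s i = s (i + 1) * s i * s (i + 1))
    {j k : ℕ} (hk : k ≤ m) (hj : j + 1 ≤ k) :
    descProd s j * descProd s k * s 0 = descProd s k * descProd s (j + 1) := by
  induction j with
  | zero => simp [descProd]
  | succ j ih =>
    rw [descProd, mul_assoc, mul_assoc, ← mul_assoc (descProd s j), ih (by omega), ← mul_assoc,
      mul_descProd hcomm hbraid hk hj, mul_assoc, ← descProd_succ]

theorem mul_halfTwist {s : ℕ → M} {m : ℕ} (hcomm : ∀ i j, i + 2 ≤ j → s i * s j = s j * s i)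
    (hbraid : ∀ i, i + 1 < m → s i * s (i + 1) * s i = s (i + 1) * s i * s (i + 1))
    {i j k : ℕ} (hk : k ≤ m + 1) (h : i + j + 2 = k) :
    s i * halfTwist s k = halfTwist s k * s j := by
  induction k generalizing j with
  | zero => omega
  | succ k ih =>
    cases j with
    | zero =>
      obtain rfl : i + 1 = k := by omega
      have hc : s i * halfTwist s i = halfTwist s i * s i := commute_halfTwist hcomm le_rfl
      rw [halfTwist, halfTwist, ← mul_assoc, ← mul_assoc, hc, mul_assoc (halfTwist s i),
        ← descProd_succ, mul_assoc, ← descProd_mul_descProd_mul hcomm hbraid (by omega) le_rfl]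
      simp only [mul_assoc]
    | succ j =>
      rw [halfTwist, ← mul_assoc, ih (j := j) (by omega) (by omega), mul_assoc,
        mul_descProd hcomm hbraid (by omega) (by omega), mul_assoc]

theorem exists_halfTwist_eq_mul {s : ℕ → M} {m : ℕ}
    (hcomm : ∀ i j, i + 2 ≤ j → s i * s j = s j * s i)
    (hbraid : ∀ i, i + 1 < m → s i * s (i + 1) * s i = s (i + 1) * s i * s (i + 1))
    {i k : ℕ} (hk : k ≤ m + 1) (h : i + 2 ≤ k) : ∃ y, halfTwist s k = y * s i := by
  induction k generalizing i with
  | zero => omega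
  | succ k ih =>
    cases i with
    | zero =>
      obtain ⟨k, rfl⟩ : ∃ l, k = l + 1 := ⟨k - 1, by omega⟩
      obtain ⟨y, hy⟩ := exists_descProd_eq_mul s k
      exact ⟨halfTwist s (k + 1) * y, by rw [halfTwist, hy, mul_assoc]⟩
    | succ i =>
      obtain ⟨y, hy⟩ := ih (i := i) (by omega) (by omega)
      exact ⟨y * descProd s k, by
        rw [halfTwist, hy, mul_assoc, mul_descProd hcomm hbraid (by omega) (by omega), mul_assoc]⟩

end HalfTwist

namespace BraidMonoid

variable {n : ℕ}

/-- The indices of two braid generators that satisfy the braid relation of length three. -/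
def Adj (i j : Fin (n - 1)) : Prop := (i : ℕ) + 1 = j ∨ (j : ℕ) + 1 = i

/-- The indices of two distinct braid generators that commute. -/
def Far (i j : Fin (n - 1)) : Prop := (i : ℕ) + 2 ≤ j ∨ (j : ℕ) + 2 ≤ i

theorem Adj.symm {i j : Fin (n - 1)} (h : Adj i j) : Adj j i := Or.symm h

theorem Far.symm {i j : Fin (n - 1)} (h : Far i j) : Far j i := Or.symm h

theorem not_adj_self (i : Fin (n - 1)) : ¬ Adj i i := by simp [Adj]

theorem not_far_self (i : Fin (n - 1)) : ¬ Far i i := by simp [Far]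

theorem eq_or_far_or_adj (i j : Fin (n - 1)) : i = j ∨ Far i j ∨ Adj i j := by
  simp only [Far, Adj, Fin.ext_iff]
  omega

theorem Adj.not_far {i j : Fin (n - 1)} (h : Adj i j) : ¬ Far i j := by
  simp only [Far, Adj] at *
  omega

theorem Adj.eq_or_far {i j k : Fin (n - 1)} (h : Adj i k) (h' : Adj k j) : i = j ∨ Far i j := by
  simp only [Far, Adj, Fin.ext_iff] at *
  omega

theorem sigma_comm {i j : Fin (n - 1)} (h : Far i j) : (σ i * σ j : BraidMonoid n) = σ j * σ i := by
  obtain h | h := h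
  · exact PresentedMonoid.mk_eq_mk_of_rel (Or.inr ⟨i, j, h, rfl, rfl⟩)
  · exact (PresentedMonoid.mk_eq_mk_of_rel (Or.inr ⟨j, i, h, rfl, rfl⟩)).symm

theorem sigma_braid {i j : Fin (n - 1)} (h : Adj i j) :
    (σ i * σ j * σ i : BraidMonoid n) = σ j * σ i * σ j := by
  obtain h | h := h
  · exact PresentedMonoid.mk_eq_mk_of_rel (Or.inl ⟨i, j, h, rfl, rfl⟩)
  · exact (PresentedMonoid.mk_eq_mk_of_rel (Or.inl ⟨j, i, h, rfl, rfl⟩)).symm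

theorem sigma_comm_mul {i j : Fin (n - 1)} (h : Far i j) (x : BraidMonoid n) :
    σ i * (σ j * x) = σ j * (σ i * x) := by
  rw [← mul_assoc, sigma_comm h, mul_assoc]

theorem sigma_braid_mul {i j : Fin (n - 1)} (h : Adj i j) (x : BraidMonoid n) :
    σ i * (σ j * (σ i * x)) = σ j * (σ i * (σ j * x)) := by
  simpa only [mul_assoc] using congrArg (· * x) (sigma_braid h)

theorem induction_sigma_mul {p : BraidMonoid n → Prop} (one : p 1)
    (mul : ∀ i x, p x → p (σ i * x)) (x : BraidMonoid n) : p x := by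
  induction x using PresentedMonoid.inductionOn with
  | h a =>
    induction a using FreeMonoid.inductionOn' with
    | one => exact one
    | of_mul i a ih => exact mul i _ ih

/-- The word length, as a monoid homomorphism. -/
def lengthHom (n : ℕ) : BraidMonoid n →* Multiplicative ℕ :=
  PresentedMonoid.lift (fun _ => Multiplicative.ofAdd 1) (by
    rintro a b (⟨i, j, -, rfl, rfl⟩ | ⟨i, j, -, rfl, rfl⟩) <;> simp)

/-- The word length of a positive braid. -/
def length (x : BraidMonoid n) : ℕ := (lengthHom n x).toAdd

@[simp]
theorem length_mul (x y : BraidMonoid n) : length (x * y) = length x + length y := by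
  simp [length]

@[simp]
theorem length_sigma (i : Fin (n - 1)) : length (σ i : BraidMonoid n) = 1 := rfl

/-! ### Left cancellation -/

/-- The pair `(x, y)` is a right multiple of the pair of shortest positive braids `(c, d)` such
that `σ i * c = σ j * d`. -/
def IsComplementMul (i j : Fin (n - 1)) (x y : BraidMonoid n) : Prop :=
  (i = j ∧ x = y) ∨ (Far i j ∧ ∃ z, x = σ j * z ∧ y = σ i * z) ∨
    (Adj i j ∧ ∃ z, x = σ j * (σ i * z) ∧ y = σ i * (σ j * z))

namespace IsComplementMul

theorem symm {i j : Fin (n - 1)} {x y : BraidMonoid n} (h : IsComplementMul i j x y) :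
    IsComplementMul j i y x := by
  obtain ⟨rfl, rfl⟩ | ⟨h, z, hx, hy⟩ | ⟨h, z, hx, hy⟩ := h
  · exact Or.inl ⟨rfl, rfl⟩
  · exact Or.inr (Or.inl ⟨h.symm, z, hy, hx⟩)
  · exact Or.inr (Or.inr ⟨h.symm, z, hy, hx⟩)

theorem mul_right {i j : Fin (n - 1)} {x y : BraidMonoid n} (h : IsComplementMul i j x y)
    (w : BraidMonoid n) : IsComplementMul i j (x * w) (y * w) := by
  obtain ⟨rfl, rfl⟩ | ⟨h, z, rfl, rfl⟩ | ⟨h, z, rfl, rfl⟩ := h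
  · exact Or.inl ⟨rfl, rfl⟩
  · exact Or.inr (Or.inl ⟨h, z * w, by simp only [mul_assoc], by simp only [mul_assoc]⟩)
  · exact Or.inr (Or.inr ⟨h, z * w, by simp only [mul_assoc], by simp only [mul_assoc]⟩)

theorem sigma_mul_eq {i j : Fin (n - 1)} {x y : BraidMonoid n} (h : IsComplementMul i j x y) :
    σ i * x = σ j * y := by
  obtain ⟨rfl, rfl⟩ | ⟨h, z, rfl, rfl⟩ | ⟨h, z, rfl, rfl⟩ := h
  · rfl
  · exact sigma_comm_mul h z
  · exact sigma_braid_mul h z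

theorem eq {i : Fin (n - 1)} {x y : BraidMonoid n} (h : IsComplementMul i i x y) : x = y := by
  obtain ⟨-, h⟩ | ⟨h, -⟩ | ⟨h, -⟩ := h
  · exact h
  · exact absurd h (not_far_self i)
  · exact absurd h (not_adj_self i)

theorem exists_of_far {i j : Fin (n - 1)} {x y : BraidMonoid n} (h : IsComplementMul i j x y)
    (hij : Far i j) : ∃ z, x = σ j * z ∧ y = σ i * z := by
  obtain ⟨rfl, -⟩ | ⟨-, h⟩ | ⟨h, -⟩ := h
  · exact absurd hij (not_far_self i)
  · exact h
  · exact absurd hij h.not_far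

theorem exists_of_adj {i j : Fin (n - 1)} {x y : BraidMonoid n} (h : IsComplementMul i j x y)
    (hij : Adj i j) : ∃ z, x = σ j * (σ i * z) ∧ y = σ i * (σ j * z) := by
  obtain ⟨rfl, -⟩ | ⟨h, -⟩ | ⟨-, h⟩ := h
  · exact absurd hij (not_adj_self i)
  · exact absurd h hij.not_far
  · exact h

/-- Any equality of products starting with generators, with cofactors of length less than `L`,
comes from the complements of these generators. -/
def BelowLength (n L : ℕ) : Prop :=
  ∀ (i j : Fin (n - 1)) (x y : BraidMonoid n), length x < L → σ i * x = σ j * y →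
    IsComplementMul i j x y

theorem trans_far_adj {i j k : Fin (n - 1)} {z w : BraidMonoid n} {L : ℕ} (H : BelowLength n L)
    (hz : length z + 1 ≤ L) (hik : Far i k) (hkj : Adj k j)
    (h : σ i * z = σ j * (σ k * w)) : IsComplementMul i j (σ k * z) (σ k * (σ j * w)) := by
  have hji := H i j _ _ hz h
  obtain rfl | hij | hij := eq_or_far_or_adj i j
  · exact absurd hik hkj.symm.not_far
  · obtain ⟨u, rfl, hu⟩ := hji.exists_of_far hij
    have hl := congrArg length hu
    simp only [length_mul, length_sigma] at hz hl
    obtain ⟨t, rfl, rfl⟩ := (H k i _ _ (by omega) hu).exists_of_far hik.symm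
    refine Or.inr (Or.inl ⟨hij, σ k * (σ j * t), sigma_braid_mul hkj t, ?_⟩)
    rw [sigma_comm_mul hij.symm, sigma_comm_mul hik.symm]
  · obtain ⟨u, rfl, hu⟩ := hji.exists_of_adj hij
    have hl := congrArg length hu
    simp only [length_mul, length_sigma] at hz hl
    obtain ⟨t, rfl, ht⟩ := (H k i _ _ (by omega) hu).exists_of_far hik.symm
    have hl' := congrArg length ht
    simp only [length_mul, length_sigma] at hl hl'
    obtain ⟨r, rfl, rfl⟩ := (H j k _ _ (by omega) ht).exists_of_adj hkj.symm
    refine Or.inr (Or.inr ⟨hij, σ k * (σ j * (σ i * r)), ?_, ?_⟩)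
    · rw [sigma_comm_mul hik (σ j * r), sigma_braid_mul hkj, sigma_braid_mul hij.symm,
        sigma_comm_mul hik.symm]
    · rw [sigma_braid_mul hij.symm (σ k * r), sigma_comm_mul hik.symm, sigma_comm_mul hik r,
        sigma_braid_mul hkj]

theorem trans {i j k : Fin (n - 1)} {x v y : BraidMonoid n} {L : ℕ} (H : BelowLength n L)
    (hL : length v ≤ L) (h₁ : IsComplementMul i k x v) (h₂ : IsComplementMul k j v y) :
    IsComplementMul i j x y := by
  obtain ⟨rfl, rfl⟩ | ⟨hik, z, rfl, rfl⟩ | ⟨hik, z, rfl, rfl⟩ := h₁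
  · exact h₂
  · obtain ⟨rfl, rfl⟩ | ⟨hkj, w, h, rfl⟩ | ⟨hkj, w, h, rfl⟩ := h₂
    · exact Or.inr (Or.inl ⟨hik, z, rfl, rfl⟩)
    · simp only [length_mul, length_sigma] at hL
      have hz := H i j z w (by omega) h
      obtain rfl | hij | hij := eq_or_far_or_adj i j
      · rw [hz.eq]
        exact Or.inl ⟨rfl, rfl⟩
      · obtain ⟨u, rfl, rfl⟩ := hz.exists_of_far hij
        exact Or.inr (Or.inl ⟨hij, σ k * u, sigma_comm_mul hkj u, sigma_comm_mul hik.symm u⟩)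
      · obtain ⟨u, rfl, rfl⟩ := hz.exists_of_adj hij
        refine Or.inr (Or.inr ⟨hij, σ k * u, ?_, ?_⟩)
        · rw [sigma_comm_mul hkj, sigma_comm_mul hik.symm]
        · rw [sigma_comm_mul hik.symm, sigma_comm_mul hkj]
    · simp only [length_mul, length_sigma] at hL
      exact trans_far_adj H (by omega) hik hkj h
  · obtain ⟨rfl, rfl⟩ | ⟨hkj, w, h, rfl⟩ | ⟨hkj, w, h, rfl⟩ := h₂
    · exact Or.inr (Or.inr ⟨hik, z, rfl, rfl⟩)
    · have hl := congrArg length h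
      simp only [length_mul, length_sigma] at hL hl
      exact (trans_far_adj H (by omega) hkj.symm hik.symm h.symm).symm
    · have hl := congrArg length h
      simp only [length_mul, length_sigma] at hL hl
      have hz := H i j _ _ (by simp; omega) h
      obtain rfl | hij := hik.eq_or_far hkj
      · rw [(H k k z w (by omega) hz.eq).eq]
        exact Or.inl ⟨rfl, rfl⟩
      · obtain ⟨u, hu, hu'⟩ := hz.exists_of_far hij
        obtain ⟨t, rfl, rfl⟩ := (H k j _ _ (by omega) hu).exists_of_adj hkj
        obtain ⟨r, rfl, hr⟩ := (H k i _ _ (by omega) hu').exists_of_adj hik.symm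
        have hl' := congrArg length hr
        simp only [length_mul, length_sigma] at hL hl hl'
        have ht := H k k _ _ (by simp; omega) hr
        obtain ⟨q, rfl, rfl⟩ := (H j i _ _ (by omega) ht.eq).exists_of_far hij.symm
        refine Or.inr (Or.inl ⟨hij, σ k * (σ j * (σ i * (σ k * q))), ?_, ?_⟩)
        · rw [sigma_comm_mul hij, sigma_braid_mul hik, sigma_braid_mul hkj]
        · rw [sigma_comm_mul hij.symm (σ k * (σ j * q)), sigma_braid_mul hkj.symm,
            sigma_braid_mul hik.symm, sigma_comm_mul hij (σ k * q)]

end IsComplementMul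

open IsComplementMul (BelowLength)

/-- The class of a word in the positive braid monoid. -/
def ofWord (n : ℕ) : FreeMonoid (Fin (n - 1)) →* BraidMonoid n := PresentedMonoid.mk (braidRels n)

theorem ofWord_surjective (n : ℕ) : Function.Surjective (ofWord n) :=
  PresentedMonoid.surjective_mk

theorem ofWord_eq_iff {u v : FreeMonoid (Fin (n - 1))} :
    ofWord n u = ofWord n v ↔ ConGen.Rel (braidRels n) u v :=
  PresentedMonoid.mk_eq_mk_iff

theorem ofWord_of_mul (i : Fin (n - 1)) (a : FreeMonoid (Fin (n - 1))) :
    ofWord n (.of i * a) = σ i * ofWord n a := rfl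

theorem freeMonoid_of_mul_inj {α : Type*} {i j : α} {a b : FreeMonoid α}
    (h : FreeMonoid.of i * a = .of j * b) : i = j ∧ a = b :=
  List.cons.inj h

theorem freeMonoid_of_mul_ne_one {α : Type*} (i : α) (a : FreeMonoid α) :
    FreeMonoid.of i * a ≠ 1 :=
  List.cons_ne_nil i a

/-- Two words are both empty, or they start with generators whose cofactors are a right multiple
of the complements of these generators. -/
def HeadRel (u v : FreeMonoid (Fin (n - 1))) : Prop :=
  (u = 1 ∧ v = 1) ∨ ∃ i j a b, u = .of i * a ∧ v = .of j * b ∧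
    IsComplementMul i j (ofWord n a) (ofWord n b)

theorem headRel_of_rel {L : ℕ} (H : BelowLength n L) {u v : FreeMonoid (Fin (n - 1))}
    (h : ConGen.Rel (braidRels n) u v) (hu : length (ofWord n u) ≤ L + 1) : HeadRel u v := by
  induction h with
  | of x y h =>
    obtain ⟨i, j, h, rfl, rfl⟩ | ⟨i, j, h, rfl, rfl⟩ := h
    · exact Or.inr ⟨i, j, .of j * .of i, .of i * .of j, rfl, rfl,
        Or.inr (Or.inr ⟨Or.inl h, 1, rfl, rfl⟩)⟩
    · exact Or.inr ⟨i, j, .of j, .of i, rfl, rfl, Or.inr (Or.inl ⟨Or.inl h, 1, rfl, rfl⟩)⟩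
  | refl x =>
    cases x using FreeMonoid.casesOn with
    | one => exact Or.inl ⟨rfl, rfl⟩
    | of_mul i a => exact Or.inr ⟨i, i, a, a, rfl, rfl, Or.inl ⟨rfl, rfl⟩⟩
  | symm h ih =>
    rw [← ofWord_eq_iff.2 h] at hu
    obtain ⟨rfl, rfl⟩ | ⟨i, j, a, b, rfl, rfl, hab⟩ := ih hu
    · exact Or.inl ⟨rfl, rfl⟩
    · exact Or.inr ⟨j, i, b, a, rfl, rfl, hab.symm⟩
  | trans h₁ h₂ ih₁ ih₂ =>
    have hv := hu
    rw [ofWord_eq_iff.2 h₁] at hv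
    obtain ⟨rfl, rfl⟩ | ⟨i, k, a, b, rfl, rfl, hab⟩ := ih₁ hu
    · exact ih₂ hv
    · obtain ⟨h, -⟩ | ⟨k', j, b', c, h, rfl, hbc⟩ := ih₂ hv
      · exact absurd h (freeMonoid_of_mul_ne_one _ _)
      · obtain ⟨rfl, rfl⟩ := freeMonoid_of_mul_inj h
        rw [ofWord_of_mul, length_mul, length_sigma] at hv
        exact Or.inr ⟨i, j, a, c, rfl, rfl, hab.trans H (by omega) hbc⟩
  | mul h₁ h₂ ih₁ ih₂ =>
    rw [map_mul, length_mul] at hu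
    obtain ⟨rfl, rfl⟩ | ⟨i, j, a, b, rfl, rfl, hab⟩ := ih₁ (by omega)
    · simpa only [one_mul] using ih₂ (by omega)
    · refine Or.inr ⟨i, j, _, _, mul_assoc _ _ _, mul_assoc _ _ _, ?_⟩
      rw [map_mul, map_mul, ← ofWord_eq_iff.2 h₂]
      exact hab.mul_right _

theorem belowLength (n L : ℕ) : BelowLength n L := by
  induction L with
  | zero => exact fun i j x y h => absurd h (Nat.not_lt_zero _)
  | succ L ih =>
    intro i j x y hx h
    obtain ⟨a, rfl⟩ := ofWord_surjective n x
    obtain ⟨b, rfl⟩ := ofWord_surjective n y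
    obtain ⟨h, -⟩ | ⟨i', j', a', b', hi, hj, hab⟩ := headRel_of_rel ih (ofWord_eq_iff.1 h)
      (by rw [ofWord_of_mul, length_mul, length_sigma]; omega)
    · exact absurd h (freeMonoid_of_mul_ne_one _ _)
    · obtain ⟨rfl, rfl⟩ := freeMonoid_of_mul_inj hi
      obtain ⟨rfl, rfl⟩ := freeMonoid_of_mul_inj hj
      exact hab

theorem sigma_mul_left_cancel {i : Fin (n - 1)} {x y : BraidMonoid n} (h : σ i * x = σ i * y) :
    x = y :=
  (belowLength n _ i i x y (Nat.lt_succ_self _) h).eq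

theorem mul_left_cancel' (z : BraidMonoid n) {x y : BraidMonoid n} (h : z * x = z * y) :
    x = y := by
  induction z using induction_sigma_mul with
  | one => simpa only [one_mul] using h
  | mul i z ih => exact ih (sigma_mul_left_cancel (by simpa only [mul_assoc] using h))

/-! ### Right cancellation -/

/-- Reversal of words, as a homomorphism to the opposite monoid. -/
def reverseHom (n : ℕ) : BraidMonoid n →* (BraidMonoid n)ᵐᵒᵖ :=
  PresentedMonoid.lift (fun i => MulOpposite.op (σ i)) (by
    rintro a b (⟨i, j, h, rfl, rfl⟩ | ⟨i, j, h, rfl, rfl⟩)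
    · simp only [map_mul, FreeMonoid.lift_eval_of, ← MulOpposite.op_mul, ← mul_assoc]
      rw [sigma_braid (Or.inl h)]
    · simp only [map_mul, FreeMonoid.lift_eval_of, ← MulOpposite.op_mul]
      rw [sigma_comm (Or.inl h)])

/-- The positive braid written backwards. -/
def reverse (x : BraidMonoid n) : BraidMonoid n := (reverseHom n x).unop

theorem reverse_mul (x y : BraidMonoid n) : reverse (x * y) = reverse y * reverse x := by
  simp [reverse]

theorem reverse_sigma (i : Fin (n - 1)) : reverse (σ i : BraidMonoid n) = σ i := rfl

theorem reverse_reverse (x : BraidMonoid n) : reverse (reverse x) = x := by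
  induction x using induction_sigma_mul with
  | one => simp [reverse]
  | mul i x ih => rw [reverse_mul, reverse_mul, ih, reverse_sigma, reverse_sigma]

theorem mul_right_cancel' (z : BraidMonoid n) {x y : BraidMonoid n} (h : x * z = y * z) :
    x = y := by
  have h' : reverse x = reverse y :=
    mul_left_cancel' (reverse z) (by rw [← reverse_mul, ← reverse_mul, h])
  rw [← reverse_reverse x, h', reverse_reverse]

/-! ### Common multiples -/

/-- The generators of the braid monoid, indexed by all natural numbers and extended by `1`. -/
def sigmaNat (n i : ℕ) : BraidMonoid n := if h : i < n - 1 then σ ⟨i, h⟩ else 1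

theorem sigmaNat_comm (i j : ℕ) (h : i + 2 ≤ j) :
    sigmaNat n i * sigmaNat n j = sigmaNat n j * sigmaNat n i := by
  unfold sigmaNat
  split_ifs
  · exact sigma_comm (Or.inl h)
  all_goals simp only [one_mul, mul_one]

theorem sigmaNat_braid (i : ℕ) (h : i + 1 < n - 1) :
    sigmaNat n i * sigmaNat n (i + 1) * sigmaNat n i =
      sigmaNat n (i + 1) * sigmaNat n i * sigmaNat n (i + 1) := by
  rw [sigmaNat, sigmaNat, dif_pos h, dif_pos (Nat.lt_of_succ_lt h)]
  exact sigma_braid (Or.inl rfl)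

theorem sigmaNat_val (i : Fin (n - 1)) : sigmaNat n i = σ i := dif_pos i.2

theorem exists_halfTwist_mul_eq (r : BraidMonoid n) :
    ∃ r', halfTwist (sigmaNat n) n * r = r' * halfTwist (sigmaNat n) n := by
  induction r using induction_sigma_mul with
  | one => exact ⟨1, by rw [one_mul, mul_one]⟩
  | mul i r ih =>
    obtain ⟨r', hr⟩ := ih
    refine ⟨sigmaNat n (n - 2 - i) * r', ?_⟩
    rw [← mul_assoc, ← sigmaNat_val, ← mul_halfTwist (i := n - 2 - i) (j := i) sigmaNat_comm
      sigmaNat_braid (by omega) (by omega), mul_assoc, hr, mul_assoc]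

theorem exists_mul_eq_mul (r s : BraidMonoid n) : ∃ s' r', s' * r = r' * s := by
  induction s using induction_sigma_mul generalizing r with
  | one => exact ⟨1, r, by rw [one_mul, mul_one]⟩
  | mul i s ih =>
    obtain ⟨s', r', h⟩ := ih r
    obtain ⟨y, hy⟩ := exists_halfTwist_eq_mul (m := n - 1) (i := i) (k := n) sigmaNat_comm
      sigmaNat_braid (by omega) (by omega)
    obtain ⟨t, ht⟩ := exists_halfTwist_mul_eq r'
    refine ⟨halfTwist (sigmaNat n) n * s', t * y, ?_⟩
    rw [mul_assoc, h, ← mul_assoc, ht, hy, sigmaNat_val]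
    simp only [mul_assoc]

/-! ### The embedding into the group of fractions -/

noncomputable instance (n : ℕ) : OreLocalization.OreSet (⊤ : Submonoid (BraidMonoid n)) where
  ore_right_cancel _ _ s h := ⟨1, by rw [mul_right_cancel' (s : BraidMonoid n) h]⟩
  oreDenom r s := ⟨(exists_mul_eq_mul r s).choose, trivial⟩
  oreNum r s := (exists_mul_eq_mul r s).choose_spec.choose
  ore_eq r s := (exists_mul_eq_mul r s).choose_spec.choose_spec

/-- The monoid of left fractions of positive braids. -/
abbrev Fractions (n : ℕ) : Type := OreLocalization (⊤ : Submonoid (BraidMonoid n)) (BraidMonoid n)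

/-- The canonical map from positive braids to invertible fractions. -/
noncomputable def toUnits (n : ℕ) : BraidMonoid n →* (Fractions n)ˣ :=
  IsUnit.liftRight OreLocalization.numeratorHom fun x =>
    OreLocalization.numerator_isUnit (⟨x, trivial⟩ : (⊤ : Submonoid (BraidMonoid n)))

theorem toUnits_injective (n : ℕ) : Function.Injective (toUnits n) := by
  intro x y h
  have h' : x /ₒ (1 : (⊤ : Submonoid (BraidMonoid n))) = y /ₒ 1 := congrArg Units.val h
  obtain ⟨u, v, hr, hs⟩ := OreLocalization.oreDiv_eq_iff.1 h'
  simp only [Submonoid.smul_def, smul_eq_mul, OneMemClass.coe_one, mul_one] at hr hs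
  rw [hs] at hr
  exact (mul_left_cancel' v hr).symm

/-- The homomorphism from the braid group to the invertible fractions. -/
noncomputable def braidGroupToUnits (n : ℕ) : BraidGroup n →* (Fractions n)ˣ :=
  PresentedGroup.toGroup (f := fun i => toUnits n (σ i)) (by
    rintro r (⟨i, j, h, rfl⟩ | ⟨i, j, h, rfl⟩)
    · simpa only [map_mul, map_inv, FreeGroup.lift_apply_of, mul_inv_eq_one] using
        congrArg (toUnits n) (sigma_braid (Or.inl h))
    · simpa only [map_mul, map_inv, FreeGroup.lift_apply_of, mul_inv_eq_one] using
        congrArg (toUnits n) (sigma_comm (Or.inl h)))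

theorem braidGroupToUnits_toBraidGroup (x : BraidMonoid n) :
    braidGroupToUnits n (toBraidGroup n x) = toUnits n x := by
  induction x using induction_sigma_mul with
  | one => simp only [map_one]
  | mul i x ih =>
    rw [map_mul, map_mul, map_mul, ih, toBraidGroup_sigma]
    exact congrArg (· * _) (PresentedGroup.toGroup.of _)

end BraidMonoid

/-- The canonical monoid homomorphism from the positive braid monoid `B_n⁺` to the braid
group `B_n`, sending each generator `σ_i` of the monoid to the corresponding generator of
the group, is injective. -/
theorem toBraidGroup_injective (n : ℕ) (hn : 1 ≤ n) :
    Function.Injective (toBraidGroup n) := by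
  exact Function.Injective.of_comp (f := BraidMonoid.braidGroupToUnits n) fun x y h =>
    BraidMonoid.toUnits_injective n (by
      simpa only [Function.comp_apply, BraidMonoid.braidGroupToUnits_toBraidGroup] using h)
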